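/- arXiv:1608.01452 — 3 statements merged into one kernel-verified Lean document; each statement's English description precedes it below -/
import Mathlib

section
/- Let σ be a sign homomorphism of W and let M be a positive integer. If a weight λ ∈ P admits w ∈ W with σ(w) = −1 and q^∨ ∈ Q^∨ such that wλ + M q^∨ = λ, then the Weyl-orbit function φ^σ_λ vanishes identically on the lattice (1/M)P, i.e. φ^σ_λ(a) = 0 for all a ∈ (1/M)P. -/
open scoped BigOperators RealInnerProductSpace

/-- The Weyl-orbit function `φ^σ_λ(a) = Σ_{w∈W} σ(w)·e^{2πi⟨wλ,a⟩}`, for a finite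
group `W` of linear isometries of `ℝⁿ` and a sign homomorphism `σ : W → {±1}`. -/
noncomputable def orbitFn {n : ℕ}
    (W : Subgroup (EuclideanSpace ℝ (Fin n) ≃ₗᵢ[ℝ] EuclideanSpace ℝ (Fin n))) [Fintype W]
    (σ : W →* ℤˣ) (lam a : EuclideanSpace ℝ (Fin n)) : ℂ :=
  ∑ w : W, ((σ w : ℤ) : ℂ) *
    Complex.exp (2 * Real.pi * Complex.I *
      ((⟪(w : EuclideanSpace ℝ (Fin n) ≃ₗᵢ[ℝ] EuclideanSpace ℝ (Fin n)) lam, a⟫ : ℝ) : ℂ))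

/-- The orbit function is `σ`-equivariant in the weight: `φ^σ_{wλ} = σ(w) φ^σ_λ`. -/
theorem orbitFn_apply {n : ℕ}
    (W : Subgroup (EuclideanSpace ℝ (Fin n) ≃ₗᵢ[ℝ] EuclideanSpace ℝ (Fin n))) [Fintype W]
    (σ : W →* ℤˣ) (w : W) (lam a : EuclideanSpace ℝ (Fin n)) :
    orbitFn W σ ((w : EuclideanSpace ℝ (Fin n) ≃ₗᵢ[ℝ] EuclideanSpace ℝ (Fin n)) lam) a =
      ((σ w : ℤ) : ℂ) * orbitFn W σ lam a := by
  have hσ : ((σ w : ℤ) : ℂ) * ((σ w : ℤ) : ℂ) = 1 := by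
    rw [← Int.cast_mul, ← Units.val_mul, Int.units_mul_self, Units.val_one, Int.cast_one]
  unfold orbitFn
  rw [← Equiv.sum_comp (Equiv.mulRight w) (fun v : W => ((σ v : ℤ) : ℂ) *
    Complex.exp (2 * Real.pi * Complex.I *
      ((⟪(v : EuclideanSpace ℝ (Fin n) ≃ₗᵢ[ℝ] EuclideanSpace ℝ (Fin n)) lam, a⟫ : ℝ) : ℂ))),
    Finset.mul_sum]
  refine Finset.sum_congr rfl fun v _ => ?_
  simp only [Equiv.coe_mulRight, map_mul, Units.val_mul, Int.cast_mul, Subgroup.coe_mul,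
    LinearIsometryEquiv.coe_mul, Function.comp_apply]
  linear_combination (-((σ v : ℤ) : ℂ) * Complex.exp (2 * Real.pi * Complex.I *
    ((⟪(v : EuclideanSpace ℝ (Fin n) ≃ₗᵢ[ℝ] EuclideanSpace ℝ (Fin n))
      ((w : EuclideanSpace ℝ (Fin n) ≃ₗᵢ[ℝ] EuclideanSpace ℝ (Fin n)) lam), a⟫ : ℝ) : ℂ))) * hσ

/-- Shifting the weight by a vector whose orbit pairs integrally with `a` does not change the
value of the orbit function at `a`. -/
theorem orbitFn_add_of_inner_int {n : ℕ}
    (W : Subgroup (EuclideanSpace ℝ (Fin n) ≃ₗᵢ[ℝ] EuclideanSpace ℝ (Fin n))) [Fintype W]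
    (σ : W →* ℤˣ) (lam x a : EuclideanSpace ℝ (Fin n))
    (hx : ∀ w : W, ∃ m : ℤ,
      ⟪(w : EuclideanSpace ℝ (Fin n) ≃ₗᵢ[ℝ] EuclideanSpace ℝ (Fin n)) x, a⟫ = (m : ℝ)) :
    orbitFn W σ (lam + x) a = orbitFn W σ lam a := by
  refine Finset.sum_congr rfl fun w _ => ?_
  obtain ⟨m, hm⟩ := hx w
  rw [map_add, inner_add_left, hm, Complex.ofReal_add, mul_add, Complex.exp_add,
    Complex.ofReal_intCast, mul_comm _ (m : ℂ), Complex.exp_int_mul_two_pi_mul_I, mul_one]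

/-- if a weight `λ ∈ P` satisfies `wλ + M q^∨ = λ` for some `w ∈ W`
with `σ(w) = −1` and some `q^∨ ∈ Q^∨`, then `φ^σ_λ` vanishes identically on `(1/M)P`. -/
theorem orbitFn_vanishes_on_magnified_boundary {n : ℕ}
    (W : Subgroup (EuclideanSpace ℝ (Fin n) ≃ₗᵢ[ℝ] EuclideanSpace ℝ (Fin n))) [Fintype W]
    (σ : W →* ℤˣ)
    (Qv P : AddSubgroup (EuclideanSpace ℝ (Fin n)))
    -- `P` is the weight lattice, the `ℤ`-dual of the coroot lattice `Q^∨`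
    (hP : ∀ x, x ∈ P ↔ ∀ q ∈ Qv, ∃ m : ℤ, ⟪x, q⟫ = (m : ℝ))
    -- the Weyl group preserves the coroot lattice `Q^∨`
    (hWQ : ∀ (w : W), ∀ q ∈ Qv,
      (w : EuclideanSpace ℝ (Fin n) ≃ₗᵢ[ℝ] EuclideanSpace ℝ (Fin n)) q ∈ Qv)
    (M : ℕ) (hM : 0 < M)
    (lam : EuclideanSpace ℝ (Fin n)) (hlam : lam ∈ P)
    -- `λ ∈ MH^σ`: it is fixed by an affine Weyl group element whose
    -- Weyl-group part has sign `−1` under `σ`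
    (hfix : ∃ (w : W), (σ w : ℤ) = -1 ∧ ∃ qv ∈ Qv,
      (w : EuclideanSpace ℝ (Fin n) ≃ₗᵢ[ℝ] EuclideanSpace ℝ (Fin n)) lam + (M : ℝ) • qv = lam) :
    ∀ a : EuclideanSpace ℝ (Fin n), (∃ μ ∈ P, a = (M : ℝ)⁻¹ • μ) →
      orbitFn W σ lam a = 0 := by
  rintro a ⟨μ, hμ, rfl⟩
  obtain ⟨w, hw, q, hq, hfix⟩ := hfix
  have hshift := orbitFn_add_of_inner_int W σ
    ((w : EuclideanSpace ℝ (Fin n) ≃ₗᵢ[ℝ] EuclideanSpace ℝ (Fin n)) lam) ((M : ℝ) • q)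
    ((M : ℝ)⁻¹ • μ) fun v => by
      obtain ⟨m, hm⟩ := (hP μ).1 hμ _ (hWQ v q hq)
      refine ⟨m, ?_⟩
      rw [map_smul, real_inner_smul_left, real_inner_smul_right, real_inner_comm, hm,
        mul_inv_cancel_left₀ (by positivity)]
  rw [hfix, orbitFn_apply, hw] at hshift
  refine self_eq_neg.1 (hshift.trans ?_)
  push_cast
  ring
end

section
/- Let n ≥ 3 and k ≥ 0 be integers. The number of (n+1)-tuples (u_0, u_1, …, u_n) of nonnegative integers satisfying u_0 + u_1 + 2u_2 + 2u_3 + … + 2u_{n−1} + u_n = 2k equals C(n+k, n) + 3·C(n+k−1, n), and the number of such tuples satisfying u_0 + u_1 + 2u_2 + 2u_3 + … + 2u_{n−1} + u_n = 2k+1 equals 3·C(n+k, n) + C(n+k−1, n). -/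
open scoped BigOperators

/-- The stars and bars count of `(n+1)`-tuples of natural numbers with sum `s`. -/
theorem card_tuples_sum_eq (n s : ℕ) :
    Nat.card {v : Fin (n + 1) → ℕ // ∑ i, v i = s} = (n + s).choose n := by
  rw [← Nat.card_congr (Sym.equivNatSumOfFintype (Fin (n + 1)) s), Nat.card_eq_fintype_card,
    Sym.card_sym_eq_choose, Fintype.card_fin, show n + 1 + s - 1 = n + s by omega]
  exact Nat.choose_symm_add.symm

theorem finite_two_mul_sum_add_eq {ι : Type*} [Fintype ι] [DecidableEq ι] (j M : ℕ) :
    Finite {v : ι → ℕ // 2 * ∑ i, v i + j = M} := by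
  have : Finite {v : ι → ℕ // ∑ i, v i = (M - j) / 2} :=
    Finite.of_equiv _ (Sym.equivNatSumOfFintype ι ((M - j) / 2))
  exact Finite.of_injective
    (fun v : {v : ι → ℕ // 2 * ∑ i, v i + j = M} ↦
      (⟨v.1, by have := v.2; omega⟩ : {v : ι → ℕ // ∑ i, v i = (M - j) / 2}))
    fun v w h ↦ Subtype.ext (Subtype.mk.inj h)

theorem card_two_mul_sum_add_eq (n j s : ℕ) :
    Nat.card {v : Fin (n + 1) → ℕ // 2 * ∑ i, v i + j = 2 * s + j} = (n + s).choose n := by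
  rw [← card_tuples_sum_eq]
  exact Nat.card_congr (Equiv.subtypeEquivRight fun v ↦ by omega)

theorem card_two_mul_sum_add_eq_zero {ι : Type*} [Fintype ι] {j M : ℕ}
    (h : ∀ s, 2 * s + j ≠ M) : Nat.card {v : ι → ℕ // 2 * ∑ i, v i + j = M} = 0 := by
  have : IsEmpty {v : ι → ℕ // 2 * ∑ i, v i + j = M} := ⟨fun v ↦ h _ v.2⟩
  exact Nat.card_of_isEmpty

theorem sum_weight_mul_eq {ι : Type*} [Fintype ι] [DecidableEq ι] {S T : Finset ι} (hT : T ⊆ S)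
    (v : ι → ℕ) :
    ∑ i, (if i ∈ S then 1 else 2) *
        (if i ∈ S then 2 * v i + (if i ∈ T then 1 else 0) else v i) =
      2 * ∑ i, v i + T.card := by
  have hcard : T.card = ∑ i, if i ∈ T then 1 else 0 := by simp
  rw [hcard, Finset.mul_sum, ← Finset.sum_add_distrib]
  refine Finset.sum_congr rfl fun i _ ↦ ?_
  by_cases hS : i ∈ S
  · simp [hS]
  · simp [hS, mt (@hT i) hS]

/-- Splitting the coordinates of weight one into quotient and remainder modulo two. -/
noncomputable def weightedEquiv {ι : Type*} [Fintype ι] [DecidableEq ι] (S : Finset ι) (M : ℕ) :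
    (Σ T : S.powerset, {v : ι → ℕ // 2 * ∑ i, v i + T.1.card = M}) ≃
      {u : ι → ℕ // ∑ i, (if i ∈ S then 1 else 2) * u i = M} :=
  Equiv.ofBijective
    (fun p ↦ ⟨fun i ↦ if i ∈ S then 2 * p.2.1 i + (if i ∈ p.1.1 then 1 else 0) else p.2.1 i,
      (sum_weight_mul_eq (Finset.mem_powerset.1 p.1.2) p.2.1).trans p.2.2⟩) <| by
    constructor
    · rintro ⟨⟨T, hT⟩, v, hv⟩ ⟨⟨T', hT'⟩, v', hv'⟩ h
      have hi := fun i ↦ congrFun (congrArg Subtype.val h) i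
      rw [Finset.mem_powerset] at hT hT'
      obtain rfl : T = T' := by
        ext i
        have := hi i
        have := @hT i
        have := @hT' i
        grind
      obtain rfl : v = v' := by
        funext i
        have := hi i
        grind
      rfl
    · rintro ⟨u, hu⟩
      have hT : S.filter (fun i ↦ Odd (u i)) ⊆ S := Finset.filter_subset _ _
      have huv : (fun i ↦ if i ∈ S then 2 * (if i ∈ S then u i / 2 else u i) +
          (if i ∈ S.filter (fun i ↦ Odd (u i)) then 1 else 0)
          else (if i ∈ S then u i / 2 else u i)) = u := by
        funext i
        simp only [Finset.mem_filter, Nat.odd_iff]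
        grind
      refine ⟨⟨⟨_, Finset.mem_powerset.2 hT⟩, fun i ↦ if i ∈ S then u i / 2 else u i, ?_⟩,
        Subtype.ext huv⟩
      rw [← sum_weight_mul_eq hT, ← hu]
      exact Finset.sum_congr rfl fun i _ ↦ congrArg _ (congrFun huv i)

theorem card_weighted {ι : Type*} [Fintype ι] [DecidableEq ι] (S : Finset ι) (M : ℕ) :
    Nat.card {u : ι → ℕ // ∑ i, (if i ∈ S then 1 else 2) * u i = M} =
      ∑ j ∈ Finset.range (S.card + 1),
        S.card.choose j * Nat.card {v : ι → ℕ // 2 * ∑ i, v i + j = M} := by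
  have (T : S.powerset) : Finite {v : ι → ℕ // 2 * ∑ i, v i + T.1.card = M} :=
    finite_two_mul_sum_add_eq _ _
  rw [← Nat.card_congr (weightedEquiv S M), Nat.card_sigma]
  rw [Finset.sum_coe_sort S.powerset
    (fun T ↦ Nat.card {v : ι → ℕ // 2 * ∑ i, v i + T.card = M}),
    Finset.sum_powerset_apply_card (fun j ↦ Nat.card {v : ι → ℕ // 2 * ∑ i, v i + j = M})]
  simp only [smul_eq_mul]

theorem card_filter_eq_zero_or_one_or_last {n : ℕ} (hn : 2 ≤ n) :
    (Finset.univ.filter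
      fun i : Fin (n + 1) ↦ (i : ℕ) = 0 ∨ (i : ℕ) = 1 ∨ (i : ℕ) = n).card = 3 := by
  rw [Finset.card_eq_three]
  refine ⟨⟨0, by omega⟩, ⟨1, by omega⟩, ⟨n, by omega⟩, ?_, ?_, ?_, ?_⟩
  · simp
  · simp only [ne_eq, Fin.mk.injEq]; omega
  · simp only [ne_eq, Fin.mk.injEq]; omega
  · ext i
    simp only [Finset.mem_filter, Finset.mem_univ, true_and, Finset.mem_insert,
      Finset.mem_singleton, Fin.ext_iff]

theorem card_two_mul_sum_add_two_eq {n : ℕ} (hn : n ≠ 0) (j k : ℕ) :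
    Nat.card {v : Fin (n + 1) → ℕ // 2 * ∑ i, v i + (j + 2) = 2 * k + j} =
      (n + k - 1).choose n := by
  obtain _ | k := k
  · rw [Nat.choose_eq_zero_of_lt (by omega)]
    exact card_two_mul_sum_add_eq_zero fun s ↦ by omega
  · rw [show 2 * (k + 1) + j = 2 * k + (j + 2) by ring, card_two_mul_sum_add_eq]
    simp [← add_assoc]

/-- counting the points of `F^𝟙_{P,M}(B_n)`, i.e. the number of
`(n+1)`-tuples `(u_0,…,u_n)` of nonnegative integers with
`u_0 + u_1 + 2u_2 + ⋯ + 2u_{n−1} + u_n = M`, for `M = 2k` and `M = 2k+1`. -/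
theorem card_F_P_M_Bn (n k : ℕ) (hn : 3 ≤ n) :
    Nat.card {u : Fin (n + 1) → ℕ //
        ∑ i : Fin (n + 1),
          (if (i : ℕ) = 0 ∨ (i : ℕ) = 1 ∨ (i : ℕ) = n then 1 else 2) * u i = 2 * k}
      = (n + k).choose n + 3 * ((n + k - 1).choose n) ∧
    Nat.card {u : Fin (n + 1) → ℕ //
        ∑ i : Fin (n + 1),
          (if (i : ℕ) = 0 ∨ (i : ℕ) = 1 ∨ (i : ℕ) = n then 1 else 2) * u i = 2 * k + 1}
      = 3 * ((n + k).choose n) + (n + k - 1).choose n := by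
  have key := card_weighted (Finset.univ.filter
    fun i : Fin (n + 1) ↦ (i : ℕ) = 0 ∨ (i : ℕ) = 1 ∨ (i : ℕ) = n)
  simp only [card_filter_eq_zero_or_one_or_last (show 2 ≤ n by omega), Finset.mem_filter,
    Finset.mem_univ, true_and, Finset.sum_range_succ, Finset.sum_range_zero] at key
  have hn0 : n ≠ 0 := by omega
  have h0 := card_two_mul_sum_add_eq n 0 k
  have h1 := card_two_mul_sum_add_eq n 1 k
  have h2 := card_two_mul_sum_add_two_eq hn0 0 k
  have h3 := card_two_mul_sum_add_two_eq hn0 1 k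
  have e0 : Nat.card {v : Fin (n + 1) → ℕ // 2 * ∑ i, v i + 0 = 2 * k + 1} = 0 :=
    card_two_mul_sum_add_eq_zero fun s ↦ by omega
  have e1 : Nat.card {v : Fin (n + 1) → ℕ // 2 * ∑ i, v i + 1 = 2 * k} = 0 :=
    card_two_mul_sum_add_eq_zero fun s ↦ by omega
  have e2 : Nat.card {v : Fin (n + 1) → ℕ // 2 * ∑ i, v i + 2 = 2 * k + 1} = 0 :=
    card_two_mul_sum_add_eq_zero fun s ↦ by omega
  have e3 : Nat.card {v : Fin (n + 1) → ℕ // 2 * ∑ i, v i + 3 = 2 * k} = 0 :=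
    card_two_mul_sum_add_eq_zero fun s ↦ by omega
  simp only [Nat.reduceAdd, add_zero, zero_add] at key h0 h1 h2 h3 e0
  refine ⟨?_, ?_⟩
  · rw [key, h0, e1, h2, e3]
    simp [Nat.choose]
  · rw [key, e0, h1, e2, h3]
    simp [Nat.choose]
end

section
/- Let k ≥ 0 be an integer, and let N(M) denote the number of 5-tuples (u_0, u_1, u_2, u_3, u_4) of nonnegative integers satisfying u_0 + 2u_1 + 3u_2 + 2u_3 + u_4 = M. Then: N(6k) = (9/2)k⁴ + (27/2)k³ + 14k² + 6k + 1; N(6k+1) = (9/2)k⁴ + (33/2)k³ + (43/2)k² + (23/2)k + 2; N(6k+2) = (9/2)k⁴ + (39/2)k³ + (61/2)k² + (41/2)k + 5; N(6k+3) = (9/2)k⁴ + (45/2)k³ + 41k² + 32k + 9; N(6k+4) = (9/2)k⁴ + (51/2)k³ + 53k² + 48k + 16; N(6k+5) = (9/2)k⁴ + (57/2)k³ + (133/2)k² + (135/2)k + 25. -/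
open scoped BigOperators

/-- `N(M)`: the number of 5-tuples `(u_0,u_1,u_2,u_3,u_4)` of nonnegative integers
satisfying `u_0 + 2u_1 + 3u_2 + 2u_3 + u_4 = M`; this is the number of points
`|F^𝟙_{P,M}(F_4)|` for the simple Lie algebra `F_4`. -/
noncomputable def F4Count (M : ℕ) : ℕ :=
  Nat.card {u : Fin 5 → ℕ // u 0 + 2 * u 1 + 3 * u 2 + 2 * u 3 + u 4 = M}

/-- The number of `(u₀, u₁, u₃, u₄)` with `u₀ + 2u₁ + 2u₃ + u₄ = n`, grouped by `j = u₁ + u₃`. -/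
def fourPartCount (n : ℕ) : ℕ :=
  ∑ j ∈ Finset.range (n / 2 + 1), (j + 1) * (n - 2 * j + 1)

/-- Solutions of the weighted equation are parametrised by `u₂`, `u₁ + u₃`, `u₁` and `u₀`. -/
def solutionEquiv (M : ℕ) :
    {u : Fin 5 → ℕ // u 0 + 2 * u 1 + 3 * u 2 + 2 * u 3 + u 4 = M} ≃
      Σ i : Fin (M / 3 + 1), Σ j : Fin ((M - 3 * i) / 2 + 1),
        Fin (j + 1) × Fin (M - 3 * i - 2 * j + 1) where
  toFun u := ⟨⟨u.1 2, by have := u.2; omega⟩, ⟨u.1 1 + u.1 3, by have := u.2; simp only; omega⟩,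
    ⟨u.1 1, by simp only; omega⟩, ⟨u.1 0, by have := u.2; simp only; omega⟩⟩
  invFun p := ⟨![p.2.2.2, p.2.2.1, p.1, p.2.1 - p.2.2.1, M - 3 * p.1 - 2 * p.2.1 - p.2.2.2], by
    obtain ⟨⟨i, hi⟩, ⟨j, hj⟩, ⟨a, ha⟩, ⟨b, hb⟩⟩ := p
    simp only at hj ha hb
    change b + 2 * a + 3 * i + 2 * (j - a) + (M - 3 * i - 2 * j - b) = M
    omega⟩
  left_inv := by
    rintro ⟨u, hu⟩
    ext t
    fin_cases t
    · rfl
    · rfl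
    · rfl
    · change u 1 + u 3 - u 1 = u 3
      omega
    · change M - 3 * u 2 - 2 * (u 1 + u 3) - u 0 = u 4
      omega
  right_inv := by
    rintro ⟨⟨i, hi⟩, ⟨j, hj⟩, ⟨a, ha⟩, ⟨b, hb⟩⟩
    simp only at hj ha hb
    have h : a + (j - a) = j := by omega
    simp [h]
    congr!

theorem F4Count_eq_sum (M : ℕ) :
    F4Count M = ∑ i ∈ Finset.range (M / 3 + 1), fourPartCount (M - 3 * i) := by
  simp only [F4Count, fourPartCount]
  rw [Nat.card_congr (solutionEquiv M), Nat.card_eq_fintype_card, Fintype.card_sigma,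
    ← Fin.sum_univ_eq_sum_range
      (fun i ↦ ∑ j ∈ Finset.range ((M - 3 * i) / 2 + 1), (j + 1) * (M - 3 * i - 2 * j + 1))]
  refine Finset.sum_congr rfl fun i _ ↦ ?_
  rw [Fintype.card_sigma,
    ← Fin.sum_univ_eq_sum_range (fun j ↦ (j + 1) * (M - 3 * i - 2 * j + 1))]
  simp

theorem F4Count_add_three (M : ℕ) :
    F4Count (M + 3) = F4Count M + fourPartCount (M + 3) := by
  rw [F4Count_eq_sum, F4Count_eq_sum, Nat.add_div_right M (by norm_num), Finset.sum_range_succ']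
  congr 1
  refine Finset.sum_congr rfl fun i _ ↦ ?_
  congr 1
  omega

theorem F4Count_add_six (M : ℕ) :
    F4Count (M + 6) = F4Count M + fourPartCount (M + 3) + fourPartCount (M + 6) := by
  rw [F4Count_add_three (M + 3), F4Count_add_three M]

theorem sum_range_succ_mul_sub (n m : ℕ) (h : 2 * m ≤ n + 2) :
    ((∑ j ∈ Finset.range m, (j + 1) * (n - 2 * j + 1) : ℕ) : ℚ)
      = m * (m + 1) * (3 * n + 7 - 4 * m) / 6 := by
  induction m with
  | zero => simp
  | succ m ih =>
    rw [Finset.sum_range_succ, Nat.cast_add, ih (by omega)]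
    push_cast [Nat.cast_sub (show 2 * m ≤ n by omega)]
    ring

theorem fourPartCount_even (m : ℕ) :
    (fourPartCount (2 * m) : ℚ) = (m + 1) * (m + 2) * (2 * m + 3) / 6 := by
  rw [fourPartCount, sum_range_succ_mul_sub _ _ (by omega), show 2 * m / 2 = m by omega]
  push_cast
  ring

theorem fourPartCount_odd (m : ℕ) :
    (fourPartCount (2 * m + 1) : ℚ) = (m + 1) * (m + 2) * (m + 3) / 3 := by
  rw [fourPartCount, sum_range_succ_mul_sub _ _ (by omega), show (2 * m + 1) / 2 = m by omega]
  push_cast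
  ring

/-- the counting polynomials of `|F^𝟙_{P,M}(F_4)|` for
`M = 6k, 6k+1, …, 6k+5` (stated in `ℚ` because of the fractional coefficients). -/
theorem card_F_P_M_F4 (k : ℕ) :
    (F4Count (6 * k) : ℚ)
        = 9 / 2 * k ^ 4 + 27 / 2 * k ^ 3 + 14 * k ^ 2 + 6 * k + 1 ∧
    (F4Count (6 * k + 1) : ℚ)
        = 9 / 2 * k ^ 4 + 33 / 2 * k ^ 3 + 43 / 2 * k ^ 2 + 23 / 2 * k + 2 ∧
    (F4Count (6 * k + 2) : ℚ)
        = 9 / 2 * k ^ 4 + 39 / 2 * k ^ 3 + 61 / 2 * k ^ 2 + 41 / 2 * k + 5 ∧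
    (F4Count (6 * k + 3) : ℚ)
        = 9 / 2 * k ^ 4 + 45 / 2 * k ^ 3 + 41 * k ^ 2 + 32 * k + 9 ∧
    (F4Count (6 * k + 4) : ℚ)
        = 9 / 2 * k ^ 4 + 51 / 2 * k ^ 3 + 53 * k ^ 2 + 48 * k + 16 ∧
    (F4Count (6 * k + 5) : ℚ)
        = 9 / 2 * k ^ 4 + 57 / 2 * k ^ 3 + 133 / 2 * k ^ 2 + 135 / 2 * k + 25 := by
  induction k with
  | zero => simp [F4Count_eq_sum, fourPartCount, Finset.sum_range_succ]
  | succ k ih =>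
    obtain ⟨h0, h1, h2, h3, h4, h5⟩ := ih
    refine ⟨?_, ?_, ?_, ?_, ?_, ?_⟩
    · rw [show 6 * (k + 1) = 6 * k + 6 by ring, F4Count_add_six,
        show 6 * k + 3 = 2 * (3 * k + 1) + 1 by ring, show 6 * k + 6 = 2 * (3 * k + 3) by ring]
      push_cast [h0, fourPartCount_odd (3 * k + 1), fourPartCount_even (3 * k + 3)]
      ring
    · rw [show 6 * (k + 1) + 1 = 6 * k + 1 + 6 by ring, F4Count_add_six,
        show 6 * k + 1 + 3 = 2 * (3 * k + 2) by ring, show 6 * k + 1 + 6 = 2 * (3 * k + 3) + 1 by ring]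
      push_cast [h1, fourPartCount_even (3 * k + 2), fourPartCount_odd (3 * k + 3)]
      ring
    · rw [show 6 * (k + 1) + 2 = 6 * k + 2 + 6 by ring, F4Count_add_six,
        show 6 * k + 2 + 3 = 2 * (3 * k + 2) + 1 by ring, show 6 * k + 2 + 6 = 2 * (3 * k + 4) by ring]
      push_cast [h2, fourPartCount_odd (3 * k + 2), fourPartCount_even (3 * k + 4)]
      ring
    · rw [show 6 * (k + 1) + 3 = 6 * k + 3 + 6 by ring, F4Count_add_six,
        show 6 * k + 3 + 3 = 2 * (3 * k + 3) by ring, show 6 * k + 3 + 6 = 2 * (3 * k + 4) + 1 by ring]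
      push_cast [h3, fourPartCount_even (3 * k + 3), fourPartCount_odd (3 * k + 4)]
      ring
    · rw [show 6 * (k + 1) + 4 = 6 * k + 4 + 6 by ring, F4Count_add_six,
        show 6 * k + 4 + 3 = 2 * (3 * k + 3) + 1 by ring, show 6 * k + 4 + 6 = 2 * (3 * k + 5) by ring]
      push_cast [h4, fourPartCount_odd (3 * k + 3), fourPartCount_even (3 * k + 5)]
      ring
    · rw [show 6 * (k + 1) + 5 = 6 * k + 5 + 6 by ring, F4Count_add_six,
        show 6 * k + 5 + 3 = 2 * (3 * k + 4) by ring, show 6 * k + 5 + 6 = 2 * (3 * k + 5) + 1 by ring]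
      push_cast [h5, fourPartCount_even (3 * k + 4), fourPartCount_odd (3 * k + 5)]
      ring
end
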